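/- arXiv:1809.05665 — 2 statements merged into one kernel-verified Lean document; each statement's English description precedes it below -/
import Mathlib

section
/- Let 0 < p < 4 and ω² = p/4 with ω ∈ (−1,1). There exist ε > 0 and C > 0 with the following property. Let I ⊆ ℝ be an open interval, let u, v : I × ℝ → ℝ be a solution of the generalized Boussinesq system (continuously differentiable in (t,x), with u(t,·) three times continuously differentiable in x, and with u, v and the spatial derivatives appearing dominated locally uniformly in t by a fixed function in L¹(ℝ) ∩ L²(ℝ)), and let λ : I → (−1,1) and y : I → ℝ be continuously differentiable functions such that for every t ∈ I the pair ξ(t,x) = u(t, x+y(t)) − φ_{λ(t)}(x), η(t,x) = v(t, x+y(t)) + λ(t)·φ_{λ(t)}(x) satisfies ∫_ℝ ξ(t,x)·γ_{λ(t)}(x) dx = 0, ∫_ℝ ξ(t,x)·φ_{λ(t)}(x) dx = 0, and ‖(ξ(t,·), η(t,·))‖_{H¹×L²} + |λ(t) − ω| ≤ ε. Then for every t ∈ I: |λ̇(t)| ≤ C·‖(ξ(t,·),η(t,·))‖_{H¹×L²}, and | ẏ(t) − λ(t) + ‖φ_{λ(t)}‖_{L²}^{−2}·∫_ℝ η(t,x)·φ_{λ(t)}(x)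 dx | ≤ C·( ‖(ξ(t,·),η(t,·))‖²_{H¹×L²} + |λ(t)−ω|·‖(ξ(t,·),η(t,·))‖_{H¹×L²} ). -/
open MeasureTheory Real Filter

/-- The explicit ground state `φ_ω` of `-φ'' + (1-ω²)φ = φ^{p+1}`. -/
noncomputable def phi (p ω : ℝ) : ℝ → ℝ := fun x =>
  ((p + 2) * (1 - ω ^ 2) / 2) ^ (1 / p) *
    Real.cosh (p / 2 * Real.sqrt (1 - ω ^ 2) * x) ^ (-(2 / p))

/-- `γ_ω(x) = ∫₀ˣ φ_ω(y) dy`, the odd antiderivative of `φ_ω`. -/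
noncomputable def gam (p ω : ℝ) : ℝ → ℝ := fun x => ∫ y in (0 : ℝ)..x, phi p ω y

/-- Squared `H¹ × L²` norm of a pair: `∫ (f'² + f² + g²)`. -/
noncomputable def pairNormSq (f g : ℝ → ℝ) : ℝ :=
  ∫ x : ℝ, ((deriv f x) ^ 2 + (f x) ^ 2 + (g x) ^ 2)

/-- `H¹ × L²` norm of a pair. -/
noncomputable def pairNorm (f g : ℝ → ℝ) : ℝ := Real.sqrt (pairNormSq f g)

/-- The ground state at zero frequency, from which all the others are obtained by scaling. -/
noncomputable def profile (p : ℝ) : ℝ → ℝ := fun x =>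
  ((p + 2) / 2) ^ (1 / p) * cosh (p / 2 * x) ^ (-(2 / p))

/-- The derivative of `profile p`. -/
noncomputable def profileDeriv (p : ℝ) : ℝ → ℝ := fun x =>
  -(sinh (p / 2 * x) / cosh (p / 2 * x)) * profile p x

/-- The odd antiderivative of `profile p`. -/
noncomputable def profilePrim (p : ℝ) : ℝ → ℝ := fun x => ∫ y in (0 : ℝ)..x, profile p y

/-- The rescaling `x ↦ s ^ k * H (s * x)` with `s = √(1 - l²)`. -/
noncomputable def scaled (k : ℝ) (H : ℝ → ℝ) (l : ℝ) : ℝ → ℝ := fun x =>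
  √(1 - l ^ 2) ^ k * H (√(1 - l ^ 2) * x)

lemma sqrt_one_sub_sq_pos {l : ℝ} (h1 : -1 < l) (h2 : l < 1) : 0 < √(1 - l ^ 2) :=
  Real.sqrt_pos.2 (by nlinarith)

lemma phi_eq_scaled {p l : ℝ} (hp : 0 < p) (h1 : -1 < l) (h2 : l < 1) :
    phi p l = scaled (2 / p) (profile p) l := by
  ext x
  have h : (0 : ℝ) < 1 - l ^ 2 := by nlinarith
  have hs : (1 - l ^ 2) ^ (1 / p) = √(1 - l ^ 2) ^ (2 / p) := by
    rw [Real.sqrt_eq_rpow, ← Real.rpow_mul h.le]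
    congr 1
    ring
  have hm : (p + 2) * (1 - l ^ 2) / 2 = (1 - l ^ 2) * ((p + 2) / 2) := by ring
  simp only [phi, scaled, profile]
  rw [hm, Real.mul_rpow h.le (by positivity), hs]
  simp only [mul_assoc]

lemma gam_eq_scaled {p l : ℝ} (hp : 0 < p) (h1 : -1 < l) (h2 : l < 1) :
    gam p l = scaled (2 / p - 1) (profilePrim p) l := by
  ext x
  have hs := sqrt_one_sub_sq_pos h1 h2
  simp only [gam, phi_eq_scaled hp h1 h2, scaled, profilePrim]
  rw [intervalIntegral.integral_const_mul,
    intervalIntegral.integral_comp_mul_left (fun y => profile p y) hs.ne', Real.rpow_sub hs,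
    Real.rpow_one]
  simp only [mul_zero, smul_eq_mul]
  ring

lemma profile_pos {p : ℝ} (hp : 0 < p) (x : ℝ) : 0 < profile p x := by
  have := cosh_pos (p / 2 * x)
  unfold profile
  positivity

lemma hasDerivAt_profile {p : ℝ} (hp : 0 < p) (x : ℝ) :
    HasDerivAt (profile p) (profileDeriv p x) x := by
  have hc := cosh_pos (p / 2 * x)
  have h := ((((hasDerivAt_id x).const_mul (p / 2)).cosh.rpow_const (p := -(2 / p))
    (Or.inl hc.ne')).const_mul (((p + 2) / 2) ^ (1 / p)))
  refine h.congr_deriv ?_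
  simp only [id, profileDeriv, profile]
  rw [Real.rpow_sub hc, Real.rpow_one]
  field_simp

lemma continuous_profile {p : ℝ} (hp : 0 < p) : Continuous (profile p) :=
  continuous_iff_continuousAt.2 fun x => (hasDerivAt_profile hp x).continuousAt

lemma continuous_profileDeriv {p : ℝ} (hp : 0 < p) : Continuous (profileDeriv p) := by
  have h := continuous_profile hp
  unfold profileDeriv
  refine (Continuous.neg (Continuous.div ?_ ?_ fun x => (cosh_pos _).ne')).mul h
  · exact continuous_sinh.comp (by fun_prop)
  · exact continuous_cosh.comp (by fun_prop)

lemma hasDerivAt_profilePrim {p : ℝ} (hp : 0 < p) (x : ℝ) :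
    HasDerivAt (profilePrim p) (profile p x) x :=
  intervalIntegral.integral_hasDerivAt_right ((continuous_profile hp).intervalIntegrable _ _)
    ((continuous_profile hp).stronglyMeasurableAtFilter _ _) (continuous_profile hp).continuousAt

lemma profile_neg (p x : ℝ) : profile p (-x) = profile p x := by
  simp [profile, cosh_neg]

lemma profileDeriv_neg (p x : ℝ) : profileDeriv p (-x) = -profileDeriv p x := by
  simp [profileDeriv, profile_neg, cosh_neg, sinh_neg, neg_div]

lemma profilePrim_neg (p x : ℝ) : profilePrim p (-x) = -profilePrim p x := by
  have h := intervalIntegral.integral_comp_neg (a := 0) (b := x) (fun y => profile p y)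
  simp only [profile_neg, neg_zero] at h
  rw [profilePrim, profilePrim, h, intervalIntegral.integral_symm]

lemma abs_profileDeriv_le {p : ℝ} (hp : 0 < p) (x : ℝ) : |profileDeriv p x| ≤ profile p x := by
  have hc := cosh_pos (p / 2 * x)
  have h1 : |sinh (p / 2 * x)| ≤ cosh (p / 2 * x) :=
    abs_le_of_sq_le_sq (by nlinarith [cosh_sq (p / 2 * x)]) hc.le
  rw [profileDeriv, abs_mul, abs_neg, abs_div, abs_of_pos hc, abs_of_pos (profile_pos hp x)]
  exact mul_le_of_le_one_left (profile_pos hp x).le ((div_le_one hc).2 h1)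

lemma exists_profile_le {p : ℝ} (hp : 0 < p) : ∃ K > 0, ∀ x, profile p x ≤ K / (1 + x ^ 2) := by
  refine ⟨((p + 2) / 2) ^ (1 / p) * 2 ^ (2 / p) * 2, by positivity, fun x => ?_⟩
  have h1 : exp (p / 2 * |x|) / 2 ≤ cosh (p / 2 * x) := by
    have h2 : cosh (p / 2 * x) = cosh (p / 2 * |x|) := by
      rw [← cosh_abs, abs_mul, abs_of_pos (by positivity : 0 < p / 2)]
    rw [h2, cosh_eq]
    have := exp_pos (-(p / 2 * |x|))
    linarith
  have h3 : cosh (p / 2 * x) ^ (-(2 / p)) ≤ (exp (p / 2 * |x|) / 2) ^ (-(2 / p)) :=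
    Real.rpow_le_rpow_of_nonpos (by positivity) h1 (by simp; positivity)
  have h4 : (exp (p / 2 * |x|) / 2) ^ (-(2 / p)) = 2 ^ (2 / p) * exp (-|x|) := by
    rw [Real.div_rpow (exp_pos _).le (by norm_num), ← Real.exp_mul,
      Real.rpow_neg (by norm_num : (0 : ℝ) ≤ 2), div_inv_eq_mul, mul_comm]
    congr 2
    field_simp
  have h5 : exp (-|x|) ≤ 2 / (1 + x ^ 2) := by
    rw [Real.exp_neg, inv_le_comm₀ (exp_pos _) (by positivity), inv_div]
    have := Real.quadratic_le_exp_of_nonneg (abs_nonneg x)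
    rw [sq_abs] at this
    have := abs_nonneg x
    linarith
  calc profile p x ≤ ((p + 2) / 2) ^ (1 / p) * (2 ^ (2 / p) * (2 / (1 + x ^ 2))) := by
        unfold profile
        gcongr
        rw [h4] at h3
        exact h3.trans (by gcongr)
    _ = _ := by ring

lemma memLp_two_of_abs_le {f : ℝ → ℝ} (hf : Continuous f) {K : ℝ}
    (h : ∀ x, |f x| ≤ K * ((1 + |x|) / (1 + x ^ 2))) : MemLp f 2 := by
  rw [memLp_two_iff_integrable_sq hf.aestronglyMeasurable]
  refine (integrable_inv_one_add_sq.const_mul (K ^ 2 * 2)).mono'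
    (hf.pow 2).aestronglyMeasurable (ae_of_all _ fun x => ?_)
  rw [Real.norm_eq_abs, abs_pow]
  have h0 : (1 + |x|) ^ 2 ≤ 2 * (1 + x ^ 2) := by
    nlinarith [sq_nonneg (1 - |x|), sq_abs x]
  calc |f x| ^ 2 ≤ (K * ((1 + |x|) / (1 + x ^ 2))) ^ 2 := by gcongr; exact h x
    _ = K ^ 2 * ((1 + |x|) ^ 2 / (1 + x ^ 2) ^ 2) := by rw [mul_pow, div_pow]
    _ ≤ K ^ 2 * (2 * (1 + x ^ 2) / (1 + x ^ 2) ^ 2) := by gcongr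
    _ = K ^ 2 * 2 * (1 + x ^ 2)⁻¹ := by field_simp

lemma memLp_profile {p : ℝ} (hp : 0 < p) : MemLp (profile p) 2 := by
  obtain ⟨K, hK, h⟩ := exists_profile_le hp
  refine memLp_two_of_abs_le (continuous_profile hp) (K := K) fun x => ?_
  rw [abs_of_pos (profile_pos hp x), ← mul_div_assoc]
  refine (h x).trans ?_
  gcongr
  nlinarith [abs_nonneg x]

lemma memLp_profileDeriv {p : ℝ} (hp : 0 < p) : MemLp (profileDeriv p) 2 :=
  (memLp_profile hp).mono (continuous_profileDeriv hp).aestronglyMeasurable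
    (ae_of_all _ fun x => (abs_profileDeriv_le hp x).trans (le_abs_self _))

lemma memLp_id_mul_profile {p : ℝ} (hp : 0 < p) : MemLp (fun x => x * profile p x) 2 := by
  obtain ⟨K, hK, h⟩ := exists_profile_le hp
  refine memLp_two_of_abs_le (continuous_id.mul (continuous_profile hp)) (K := K) fun x => ?_
  rw [abs_mul, abs_of_pos (profile_pos hp x)]
  calc |x| * profile p x ≤ |x| * (K / (1 + x ^ 2)) := by gcongr; exact h x
    _ = K * (|x| / (1 + x ^ 2)) := by ring
    _ ≤ _ := by gcongr; linarith

lemma memLp_id_mul_profileDeriv {p : ℝ} (hp : 0 < p) :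
    MemLp (fun x => x * profileDeriv p x) 2 :=
  (memLp_id_mul_profile hp).mono
    (continuous_id.mul (continuous_profileDeriv hp)).aestronglyMeasurable
    (ae_of_all _ fun x => by
      rw [norm_mul, norm_mul]
      gcongr
      exact (abs_profileDeriv_le hp x).trans (le_abs_self _))

lemma exists_abs_profile_le {p : ℝ} (hp : 0 < p) :
    ∃ K, ∀ x, |profile p x| ≤ K ∧ |x * profile p x| ≤ K := by
  obtain ⟨K, hK, h⟩ := exists_profile_le hp
  refine ⟨K, fun x => ⟨?_, ?_⟩⟩
  · rw [abs_of_pos (profile_pos hp x)]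
    exact (h x).trans (div_le_self hK.le (by nlinarith))
  · rw [abs_mul, abs_of_pos (profile_pos hp x)]
    calc |x| * profile p x ≤ |x| * (K / (1 + x ^ 2)) := by gcongr; exact h x
      _ = K * (|x| / (1 + x ^ 2)) := by ring
      _ ≤ K * 1 := by
        gcongr
        rw [div_le_one (by positivity)]
        nlinarith [sq_nonneg (1 - |x|), sq_abs x]
      _ = K := mul_one K

lemma integrable_profile {p : ℝ} (hp : 0 < p) : Integrable (profile p) := by
  obtain ⟨K, -, h⟩ := exists_profile_le hp
  refine (integrable_inv_one_add_sq.const_mul K).mono'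
    (continuous_profile hp).aestronglyMeasurable (ae_of_all _ fun x => ?_)
  rw [Real.norm_eq_abs, abs_of_pos (profile_pos hp x)]
  exact h x

lemma exists_abs_profilePrim_le {p : ℝ} (hp : 0 < p) : ∃ K, ∀ x, |profilePrim p x| ≤ K := by
  refine ⟨∫ x, ‖profile p x‖, fun x => ?_⟩
  rw [← Real.norm_eq_abs]
  exact (intervalIntegral.norm_integral_le_integral_norm_uIoc).trans
    (setIntegral_le_integral (integrable_profile hp).norm (ae_of_all _ fun _ => norm_nonneg _))

lemma integral_eq_zero_of_odd {f : ℝ → ℝ} (hf : ∀ x, f (-x) = -f x) : ∫ x, f x = 0 := by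
  have h := integral_neg_eq_self f volume
  simp only [hf, integral_neg] at h
  linarith

lemma integral_profile_mul_id_mul_profileDeriv {p : ℝ} (hp : 0 < p) :
    ∫ x, profile p x * (x * profileDeriv p x) = -(1 / 2) * ∫ x, profile p x * profile p x := by
  have hQ := memLp_profile hp
  have i1 : Integrable fun x => profile p x * profile p x := hQ.integrable_mul hQ
  have i2 : Integrable fun x => profile p x * (x * profileDeriv p x) :=
    hQ.integrable_mul (memLp_id_mul_profileDeriv hp)
  have i3 : Integrable fun x => profile p x * (x * profile p x) :=
    hQ.integrable_mul (memLp_id_mul_profile hp)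
  have h := integral_eq_zero_of_hasDerivAt_of_integrable
    (f := fun x => profile p x * (x * profile p x))
    (f' := fun x => profile p x * profile p x + 2 * (profile p x * (x * profileDeriv p x)))
    (fun x => ((hasDerivAt_profile hp x).mul
      ((hasDerivAt_id x).mul (hasDerivAt_profile hp x))).congr_deriv (by
        simp only [id, Pi.mul_apply]
        ring))
    (i1.add (i2.const_mul 2)) i3
  rw [integral_add i1 (i2.const_mul 2), integral_const_mul] at h
  linarith

lemma integral_profile_mul_self_pos {p : ℝ} (hp : 0 < p) :
    0 < ∫ x, profile p x * profile p x :=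
  integral_pos_of_integrable_nonneg_nonzero
    ((continuous_profile hp).mul (continuous_profile hp))
    ((memLp_profile hp).integrable_mul (memLp_profile hp)) (fun _ => mul_self_nonneg _)
    (x := 0) (mul_pos (profile_pos hp 0) (profile_pos hp 0)).ne'

lemma continuous_scaled {H : ℝ → ℝ} (hH : Continuous H) (k l : ℝ) :
    Continuous (scaled k H l) := by
  unfold scaled
  fun_prop

lemma hasDerivAt_scaled {H h : ℝ → ℝ} (hH : ∀ z, HasDerivAt H (h z) z) (k : ℝ) {l : ℝ}
    (hl : 0 < √(1 - l ^ 2)) (x : ℝ) :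
    HasDerivAt (scaled k H l) (scaled (k + 1) h l x) x := by
  have h1 := ((hH (√(1 - l ^ 2) * x)).comp x
    ((hasDerivAt_id x).const_mul (√(1 - l ^ 2)))).const_mul (√(1 - l ^ 2) ^ k)
  refine h1.congr_deriv ?_
  simp only [scaled, Real.rpow_add_one hl.ne']
  ring

lemma abs_scaled_le {H : ℝ → ℝ} {K : ℝ} (hH : ∀ z, |H z| ≤ K) (k l x : ℝ) :
    |scaled k H l x| ≤ √(1 - l ^ 2) ^ k * K := by
  rw [scaled, abs_mul, abs_of_nonneg (Real.rpow_nonneg (Real.sqrt_nonneg _) _)]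
  gcongr
  exact hH _

lemma integral_scaled_mul_scaled (H J : ℝ → ℝ) (k m : ℝ) {l : ℝ} (hl : 0 < √(1 - l ^ 2)) :
    ∫ x, scaled k H l x * scaled m J l x = √(1 - l ^ 2) ^ (k + m - 1) * ∫ x, H x * J x := by
  have h := Measure.integral_comp_mul_left (fun z => H z * J z) (√(1 - l ^ 2))
  rw [abs_of_pos (inv_pos.2 hl), smul_eq_mul] at h
  have h2 : ∀ x, scaled k H l x * scaled m J l x = √(1 - l ^ 2) ^ (k + m) *
      (H (√(1 - l ^ 2) * x) * J (√(1 - l ^ 2) * x)) := fun x => by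
    simp only [scaled, Real.rpow_add hl]
    ring
  simp only [h2]
  rw [integral_const_mul, h, Real.rpow_sub hl, Real.rpow_one]
  ring

lemma memLp_scaled {H : ℝ → ℝ} (hc : Continuous H) (hH : MemLp H 2) (k : ℝ) {l : ℝ}
    (hl : 0 < √(1 - l ^ 2)) : MemLp (scaled k H l) 2 := by
  rw [memLp_two_iff_integrable_sq (continuous_scaled hc k l).aestronglyMeasurable]
  rw [memLp_two_iff_integrable_sq hc.aestronglyMeasurable] at hH
  have h := (hH.comp_mul_left' hl.ne').const_mul ((√(1 - l ^ 2) ^ k) ^ 2)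
  simpa only [scaled, mul_pow] using h

lemma abs_integral_mul_le_sqrt {f g : ℝ → ℝ} (hf : MemLp f 2) (hg : MemLp g 2) :
    |∫ x, f x * g x| ≤ √(∫ x, f x * f x) * √(∫ x, g x * g x) := by
  have h := integral_mul_le_Lp_mul_Lq_of_nonneg (μ := volume) Real.HolderConjugate.two_two
    (f := fun x => |f x|) (g := fun x => |g x|) (ae_of_all _ fun x => abs_nonneg _)
    (ae_of_all _ fun x => abs_nonneg _) (by simpa using hf.norm) (by simpa using hg.norm)
  simp only [Real.rpow_two, sq_abs, ← Real.sqrt_eq_rpow] at h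
  simp only [← sq]
  refine le_trans ?_ h
  simp only [← abs_mul]
  exact abs_integral_le_integral_abs

lemma rpow_le_rpow_neg_abs {a s : ℝ} (ha : 0 < a) (has : a ≤ s) (hs : s ≤ 1) (k : ℝ) :
    s ^ k ≤ a ^ (-|k|) :=
  (Real.rpow_le_rpow_of_exponent_ge (ha.trans_le has) hs (neg_abs_le k)).trans
    (Real.rpow_le_rpow_of_nonpos ha has (by simp))

lemma rpow_abs_le_rpow {a s : ℝ} (ha : 0 < a) (has : a ≤ s) (hs : s ≤ 1) (k : ℝ) :
    a ^ |k| ≤ s ^ k :=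
  (Real.rpow_le_rpow ha.le has (abs_nonneg k)).trans
    (Real.rpow_le_rpow_of_exponent_ge (ha.trans_le has) hs (le_abs_self k))

/-- Pairing with a rescaled `L²` function is bounded uniformly over frequencies away from `±1`. -/
lemma exists_abs_integral_mul_scaled_le {H : ℝ → ℝ} (hc : Continuous H) (hH : MemLp H 2) (k : ℝ)
    {a : ℝ} (ha : 0 < a) : ∃ K, 0 ≤ K ∧ ∀ l, a ≤ √(1 - l ^ 2) → ∀ f : ℝ → ℝ, MemLp f 2 →
      |∫ x, f x * scaled k H l x| ≤ K * √(∫ x, f x * f x) := by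
  refine ⟨√(a ^ (-|k + k - 1|) * ∫ x, H x * H x), Real.sqrt_nonneg _, fun l hl f hf => ?_⟩
  have hl0 := ha.trans_le hl
  have hl1 : √(1 - l ^ 2) ≤ 1 := Real.sqrt_le_one.2 (by nlinarith [sq_nonneg l])
  refine (abs_integral_mul_le_sqrt hf (memLp_scaled hc hH k hl0)).trans ?_
  rw [mul_comm, integral_scaled_mul_scaled H H k k hl0]
  gcongr
  · exact integral_nonneg fun x => mul_self_nonneg _
  · exact rpow_le_rpow_neg_abs ha hl hl1 _

lemma differentiable_slices {I : Set ℝ} (hI : IsOpen I) {u : ℝ → ℝ → ℝ}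
    (hu : ContDiffOn ℝ 1 (fun q : ℝ × ℝ => u q.1 q.2) (I ×ˢ Set.univ)) {t : ℝ} (ht : t ∈ I)
    (x : ℝ) : DifferentiableAt ℝ (fun s => u s x) t ∧ DifferentiableAt ℝ (u t) x := by
  have h : DifferentiableAt ℝ (fun q : ℝ × ℝ => u q.1 q.2) (t, x) :=
    (hu.differentiableOn (by norm_num)).differentiableAt
      ((hI.prod isOpen_univ).mem_nhds ⟨ht, Set.mem_univ _⟩)
  exact ⟨h.comp (f := fun s => (s, x)) t (by fun_prop),
    h.comp (f := fun z => (t, z)) x (by fun_prop)⟩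

lemma hasDerivAt_scaled_transport {H h : ℝ → ℝ} (hH : ∀ z, HasDerivAt H (h z) z) (k : ℝ)
    {lam y : ℝ → ℝ} {lam' y' s : ℝ} (hlam : HasDerivAt lam lam' s) (hy : HasDerivAt y y' s)
    (h1 : -1 < lam s) (h2 : lam s < 1) (x : ℝ) :
    HasDerivAt (fun s => scaled k H (lam s) (x - y s))
      (lam' * (-lam s / (1 - lam s ^ 2)) * (k * scaled k H (lam s) (x - y s)
        + scaled k (fun z => z * h z) (lam s) (x - y s))
        - y' * scaled (k + 1) h (lam s) (x - y s)) s := by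
  have hs := sqrt_one_sub_sq_pos h1 h2
  have h0 : 0 < 1 - lam s ^ 2 := Real.sqrt_pos.1 hs
  have hS : HasDerivAt (fun s => √(1 - lam s ^ 2))
      (lam' * (-lam s / (1 - lam s ^ 2)) * √(1 - lam s ^ 2)) s := by
    refine (((hlam.pow 2).const_sub 1).sqrt h0.ne').congr_deriv ?_
    have h3 : lam' * (-lam s / (1 - lam s ^ 2)) * √(1 - lam s ^ 2) * (2 * √(1 - lam s ^ 2))
        = lam' * (-lam s / (1 - lam s ^ 2)) * (2 * √(1 - lam s ^ 2) ^ 2) := by ring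
    rw [Pi.pow_apply, div_eq_iff (by positivity), h3, Real.sq_sqrt h0.le]
    field_simp
    push_cast
    ring
  have hp := (hS.rpow_const (p := k) (Or.inl hs.ne')).mul
    ((hH (√(1 - lam s ^ 2) * (x - y s))).comp s (hS.mul (hy.const_sub x)))
  refine hp.congr_deriv ?_
  simp only [scaled, Real.rpow_add_one hs.ne', Real.rpow_sub_one hs.ne', Function.comp, Pi.mul_apply]
  field_simp
  ring

/-- Along `∂ₜu = ∂ₓv`, the pairing of the translate `u(t, · + y(t))` with a rescaled function of
frequency `λ(t)` can be differentiated in time. -/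
lemma hasDerivAt_integral_mul_scaled {I : Set ℝ} (hI : IsOpen I) {u v : ℝ → ℝ → ℝ}
    {lam y : ℝ → ℝ}
    (hu : ContDiffOn ℝ 1 (fun q : ℝ × ℝ => u q.1 q.2) (I ×ˢ Set.univ))
    (hv : ContDiffOn ℝ 1 (fun q : ℝ × ℝ => v q.1 q.2) (I ×ˢ Set.univ))
    (huv : ∀ t ∈ I, ∀ x : ℝ, deriv (fun s => u s x) t = deriv (v t) x)
    (hlam : ContDiffOn ℝ 1 lam I) (hy : ContDiffOn ℝ 1 y I)
    (hrange : ∀ t ∈ I, -1 < lam t ∧ lam t < 1) {t : ℝ} (ht : t ∈ I)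
    {δ : ℝ} (hδ : 0 < δ) {g : ℝ → ℝ} (hg : Integrable g)
    (hdom : ∀ s ∈ I, |s - t| < δ → ∀ x, |u s x| ≤ g x ∧ |v s x| ≤ g x ∧ |deriv (v s) x| ≤ g x)
    {H h : ℝ → ℝ} (hH : ∀ z, HasDerivAt H (h z) z) (hh : Continuous h) {K : ℝ}
    (hK : ∀ z, |H z| ≤ K ∧ |h z| ≤ K ∧ |z * h z| ≤ K) (k : ℝ) :
    HasDerivAt (fun s => ∫ x, u s (x + y s) * scaled k H (lam s) x)
      (-(∫ x, v t (x + y t) * scaled (k + 1) h (lam t) x)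
        + deriv lam t * (-lam t / (1 - lam t ^ 2)) *
          (k * (∫ x, u t (x + y t) * scaled k H (lam t) x)
            + ∫ x, u t (x + y t) * scaled k (fun z => z * h z) (lam t) x)
        - deriv y t * ∫ x, u t (x + y t) * scaled (k + 1) h (lam t) x) t := by
  have hHc : Continuous H := continuous_iff_continuousAt.2 fun x => (hH x).continuousAt
  have hzh : Continuous fun z => z * h z := continuous_id.mul hh
  have hK0 : 0 ≤ K := (abs_nonneg _).trans (hK 0).1
  have hshift : (fun s => ∫ x, u s (x + y s) * scaled k H (lam s) x)
      = fun s => ∫ x, u s x * scaled k H (lam s) (x - y s) := by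
    ext s
    rw [← integral_add_right_eq_self (fun x => u s x * scaled k H (lam s) (x - y s)) (y s)]
    simp only [add_sub_cancel_right]
  set Ψ' : ℝ → ℝ → ℝ := fun s x =>
    deriv lam s * (-lam s / (1 - lam s ^ 2)) * (k * scaled k H (lam s) (x - y s)
        + scaled k (fun z => z * h z) (lam s) (x - y s))
        - deriv y s * scaled (k + 1) h (lam s) (x - y s) with hΨ'
  have hlamd : ∀ s ∈ I, HasDerivAt lam (deriv lam s) s := fun s hs =>
    ((hlam.differentiableOn (by norm_num)).differentiableAt (hI.mem_nhds hs)).hasDerivAt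
  have hyd : ∀ s ∈ I, HasDerivAt y (deriv y s) s := fun s hs =>
    ((hy.differentiableOn (by norm_num)).differentiableAt (hI.mem_nhds hs)).hasDerivAt
  set B : ℝ → ℝ := fun s => √(1 - lam s ^ 2) ^ k * K
    + (|deriv lam s * (-lam s / (1 - lam s ^ 2))| *
        (|k| * (√(1 - lam s ^ 2) ^ k * K) + √(1 - lam s ^ 2) ^ k * K)
      + |deriv y s| * (√(1 - lam s ^ 2) ^ (k + 1) * K)) with hB
  have hBcont : ContinuousAt B t := by
    have c1 : ContinuousAt lam t := (hlamd t ht).continuousAt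
    have c2 : ContinuousAt (deriv lam) t :=
      (hlam.continuousOn_deriv_of_isOpen hI le_rfl).continuousAt (hI.mem_nhds ht)
    have c3 : ContinuousAt (deriv y) t :=
      (hy.continuousOn_deriv_of_isOpen hI le_rfl).continuousAt (hI.mem_nhds ht)
    have hs := sqrt_one_sub_sq_pos (hrange t ht).1 (hrange t ht).2
    have h0 : 1 - lam t ^ 2 ≠ 0 := (Real.sqrt_pos.1 hs).ne'
    have c4 : ContinuousAt (fun s => √(1 - lam s ^ 2)) t := by fun_prop
    have c5 : ∀ m : ℝ, ContinuousAt (fun s => √(1 - lam s ^ 2) ^ m) t := fun m =>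
      c4.rpow_const (Or.inl hs.ne')
    have c6 := c5 k
    have c7 := c5 (k + 1)
    have c8 : ContinuousAt (fun s => |deriv lam s * (-lam s / (1 - lam s ^ 2))|) t :=
      (c2.mul (c1.neg.div (by fun_prop) h0)).abs
    have c9 := c3.abs
    exact (c6.mul_const K).add ((c8.mul (((c6.mul_const K).const_mul _).add (c6.mul_const K))).add
      (c9.mul (c7.mul_const K)))
  have hBle : ∀ s x, |scaled k H (lam s) (x - y s)| ≤ B s ∧ |Ψ' s x| ≤ B s := by
    intro s x
    have b1 := abs_scaled_le (fun z => (hK z).1) k (lam s) (x - y s)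
    have b2 := abs_scaled_le (fun z => (hK z).2.1) (k + 1) (lam s) (x - y s)
    have b3 := abs_scaled_le (H := fun z => z * h z) (fun z => (hK z).2.2) k (lam s) (x - y s)
    have b4 : |Ψ' s x| ≤ |deriv lam s * (-lam s / (1 - lam s ^ 2))| *
        (|k| * (√(1 - lam s ^ 2) ^ k * K) + √(1 - lam s ^ 2) ^ k * K)
      + |deriv y s| * (√(1 - lam s ^ 2) ^ (k + 1) * K) := by
      refine (abs_sub _ _).trans (add_le_add ?_ ?_)
      · rw [abs_mul]
        gcongr
        refine (abs_add_le _ _).trans (add_le_add ?_ b3)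
        rw [abs_mul]
        gcongr
      · rw [abs_mul]
        gcongr
    have b5 : 0 ≤ √(1 - lam s ^ 2) ^ k * K := by positivity
    exact ⟨b1.trans (le_add_of_nonneg_right ((abs_nonneg _).trans b4)),
      b4.trans (le_add_of_nonneg_left b5)⟩
  have huc : ∀ s ∈ I, Continuous (u s) := fun s hs =>
    continuous_iff_continuousAt.2 fun x => (differentiable_slices hI hu hs x).2.continuousAt
  have hmem : ∀ᶠ s in nhds t, (s ∈ I ∧ |s - t| < δ) ∧ B s < B t + 1 := by
    have hball : ∀ᶠ s in nhds t, |s - t| < δ := Metric.ball_mem_nhds t hδ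
    exact ((hI.eventually_mem ht).and hball).and (hBcont.eventually_lt_const (by linarith))
  have hΨc : ∀ s, Continuous fun x => scaled k H (lam s) (x - y s) := fun s =>
    (continuous_scaled hHc k (lam s)).comp (by fun_prop)
  have hΨ'c : Continuous (Ψ' t) := by
    have e1 := hΨc t
    have e2 : Continuous fun x => scaled k (fun z => z * h z) (lam t) (x - y t) :=
      (continuous_scaled hzh k (lam t)).comp (by fun_prop)
    have e3 : Continuous fun x => scaled (k + 1) h (lam t) (x - y t) :=
      (continuous_scaled hh (k + 1) (lam t)).comp (by fun_prop)
    simp only [hΨ']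
    fun_prop
  have hBt := hmem.self_of_nhds.2
  have hg0 : ∀ x, 0 ≤ g x := fun x => (abs_nonneg _).trans (hdom t ht (by simpa using hδ) x).1
  have hdt := hdom t ht (by simpa using hδ)
  have hint : ∀ {f w : ℝ → ℝ}, AEStronglyMeasurable f → (∀ x, |f x| ≤ g x) → Continuous w →
      (∃ M, ∀ x, |w x| ≤ M) → Integrable fun x => f x * w x := by
    rintro f w hfm hf hw ⟨M, hM⟩
    refine (hg.mul_const M).mono' (hfm.mul hw.aestronglyMeasurable) (ae_of_all _ fun x => ?_)
    rw [Real.norm_eq_abs, abs_mul]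
    exact mul_le_mul (hf x) (hM x) (abs_nonneg _) (hg0 x)
  have hutm := (huc t ht).aestronglyMeasurable (μ := volume)
  have hvx : ∀ x, HasDerivAt (v t) (deriv (v t) x) x := fun x =>
    (differentiable_slices hI hv ht x).2.hasDerivAt
  have hvm : AEStronglyMeasurable (v t) volume :=
    (continuous_iff_continuousAt.2 fun x => (hvx x).continuousAt).aestronglyMeasurable
  have hvdm : AEStronglyMeasurable (deriv (v t)) volume :=
    (measurable_deriv (v t)).aestronglyMeasurable
  have key := (hasDerivAt_integral_of_dominated_loc_of_deriv_le (μ := volume)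
    (F := fun s x => u s x * scaled k H (lam s) (x - y s))
    (F' := fun s x => deriv (v s) x * scaled k H (lam s) (x - y s) + u s x * Ψ' s x)
    (bound := fun x => g x * (B t + 1) + g x * (B t + 1)) hmem
    (by
      filter_upwards [hI.mem_nhds ht] with s hs
      exact ((huc s hs).mul (hΨc s)).aestronglyMeasurable)
    (hint hutm (fun x => (hdt x).1) (hΨc t) ⟨B t, fun x => (hBle t x).1⟩)
    ((hvdm.mul (hΨc t).aestronglyMeasurable).add (hutm.mul hΨ'c.aestronglyMeasurable))
    (ae_of_all _ fun x s hs => by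
      have hd := hdom s hs.1.1 hs.1.2 x
      rw [Real.norm_eq_abs]
      refine (abs_add_le _ _).trans (add_le_add ?_ ?_)
      · rw [abs_mul]
        exact mul_le_mul hd.2.2 ((hBle s x).1.trans hs.2.le) (abs_nonneg _) (hg0 x)
      · rw [abs_mul]
        exact mul_le_mul hd.1 ((hBle s x).2.trans hs.2.le) (abs_nonneg _) (hg0 x))
    ((hg.mul_const _).add (hg.mul_const _))
    (ae_of_all _ fun x s hs => by
      have hd := (differentiable_slices hI hu hs.1.1 x).1.hasDerivAt
      rw [huv s hs.1.1 x] at hd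
      exact hd.mul (hasDerivAt_scaled_transport hH k (hlamd s hs.1.1) (hyd s hs.1.1)
        (hrange s hs.1.1).1 (hrange s hs.1.1).2 x))).2
  rw [hshift]
  refine key.congr_deriv ?_
  have hs := sqrt_one_sub_sq_pos (hrange t ht).1 (hrange t ht).2
  have bd : ∀ {J : ℝ → ℝ} (m : ℝ), (∀ z, |J z| ≤ K) →
      ∃ M, ∀ x, |scaled m J (lam t) (x - y t)| ≤ M := fun m hJ =>
    ⟨_, fun x => abs_scaled_le hJ m (lam t) (x - y t)⟩
  have e2 : Continuous fun x => scaled k (fun z => z * h z) (lam t) (x - y t) :=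
    (continuous_scaled hzh k (lam t)).comp (by fun_prop)
  have e3 : Continuous fun x => scaled (k + 1) h (lam t) (x - y t) :=
    (continuous_scaled hh (k + 1) (lam t)).comp (by fun_prop)
  have i1 := hint hvdm (fun x => (hdt x).2.2) (hΨc t) (bd k fun z => (hK z).1)
  have i2 := hint hvm (fun x => (hdt x).2.1) e3 (bd (k + 1) fun z => (hK z).2.1)
  have i3 := hint hvm (fun x => (hdt x).2.1) (hΨc t) (bd k fun z => (hK z).1)
  have i4 := hint hutm (fun x => (hdt x).1) (hΨc t) (bd k fun z => (hK z).1)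
  have i5 := hint hutm (fun x => (hdt x).1) e2 (bd k fun z => (hK z).2.2)
  have i6 := hint hutm (fun x => (hdt x).1) e3 (bd (k + 1) fun z => (hK z).2.1)
  have ibp := integral_mul_deriv_eq_deriv_mul_of_integrable
    (u := fun x => scaled k H (lam t) (x - y t)) (v := v t)
    (u' := fun x => scaled (k + 1) h (lam t) (x - y t)) (v' := deriv (v t))
    (fun x _ => (hasDerivAt_scaled hH k hs (x - y t)).comp_sub_const x (y t))
    (fun x _ => hvx x) (i1.congr (ae_of_all _ fun x => mul_comm _ _))
    (i2.congr (ae_of_all _ fun x => mul_comm _ _)) (i3.congr (ae_of_all _ fun x => mul_comm _ _))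
  simp only [mul_comm (scaled _ _ _ _)] at ibp
  have back : ∀ (w J : ℝ → ℝ) (m : ℝ), ∫ x, w (x + y t) * scaled m J (lam t) x
      = ∫ x, w x * scaled m J (lam t) (x - y t) := fun w J m => by
    rw [← integral_add_right_eq_self (fun x => w x * scaled m J (lam t) (x - y t)) (y t)]
    simp only [add_sub_cancel_right]
  simp only [back]
  set c := deriv lam t * (-lam t / (1 - lam t ^ 2))
  have hsplit : ∀ x, deriv (v t) x * scaled k H (lam t) (x - y t) + u t x * Ψ' t x
      = deriv (v t) x * scaled k H (lam t) (x - y t)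
        + (c * (k * (u t x * scaled k H (lam t) (x - y t))
              + u t x * scaled k (fun z => z * h z) (lam t) (x - y t))
          - deriv y t * (u t x * scaled (k + 1) h (lam t) (x - y t))) := fun x => by
    simp only [hΨ', c]
    ring
  have i7 : Integrable fun x => c * (k * (u t x * scaled k H (lam t) (x - y t))
      + u t x * scaled k (fun z => z * h z) (lam t) (x - y t)) :=
    ((i4.const_mul k).add i5).const_mul c
  have i8 := i6.const_mul (deriv y t)
  have i9 : Integrable fun x => c * (k * (u t x * scaled k H (lam t) (x - y t))
      + u t x * scaled k (fun z => z * h z) (lam t) (x - y t))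
      - deriv y t * (u t x * scaled (k + 1) h (lam t) (x - y t)) := i7.sub i8
  simp only [hsplit]
  rw [integral_add i1 i9, integral_sub i7 i8, integral_const_mul,
    integral_add (i4.const_mul k) i5, integral_const_mul, integral_const_mul, ibp]
  ring

lemma memLp_two_of_dominated {f g : ℝ → ℝ} (hf : AEStronglyMeasurable f)
    (hg : Integrable fun x => g x ^ 2) (h : ∀ x, |f x| ≤ g x) : MemLp f 2 := by
  rw [memLp_two_iff_integrable_sq hf]
  refine hg.mono' (hf.pow 2) (ae_of_all _ fun x => ?_)
  rw [Real.norm_eq_abs, abs_pow]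
  have := h x
  gcongr

lemma integral_mul_eq_add {f g J : ℝ → ℝ} (c : ℝ) (hf : MemLp f 2) (hg : MemLp g 2)
    (hJ : MemLp J 2) :
    ∫ x, f x * J x = (∫ x, (f x - c * g x) * J x) + c * ∫ x, g x * J x := by
  have h1 : Integrable fun x => (f x - c * g x) * J x := (hf.sub (hg.const_mul c)).integrable_mul hJ
  have h2 : Integrable fun x => g x * J x := hg.integrable_mul hJ
  rw [← integral_const_mul, ← integral_add h1 (h2.const_mul c)]
  congr 1
  ext x
  ring

/-- The two scalar equations obtained by differentiating the orthogonality conditions. -/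
lemma modulation_equations {p : ℝ} (hp : 0 < p) {I : Set ℝ} (hI : IsOpen I) {u v : ℝ → ℝ → ℝ}
    {lam y : ℝ → ℝ}
    (hu : ContDiffOn ℝ 1 (fun q : ℝ × ℝ => u q.1 q.2) (I ×ˢ Set.univ))
    (hv : ContDiffOn ℝ 1 (fun q : ℝ × ℝ => v q.1 q.2) (I ×ˢ Set.univ))
    (huv : ∀ t ∈ I, ∀ x : ℝ, deriv (fun s => u s x) t = deriv (v t) x)
    (hdom : ∀ t₀ ∈ I, ∃ δ > 0, ∃ g : ℝ → ℝ, Integrable g ∧ Integrable (fun x => g x ^ 2) ∧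
      ∀ t ∈ I, |t - t₀| < δ → ∀ x, |u t x| ≤ g x ∧ |v t x| ≤ g x ∧ |deriv (v t) x| ≤ g x)
    (hlam : ContDiffOn ℝ 1 lam I) (hy : ContDiffOn ℝ 1 y I)
    (hrange : ∀ t ∈ I, -1 < lam t ∧ lam t < 1)
    (hgam : ∀ t ∈ I, ∫ x, (u t (x + y t) - scaled (2 / p) (profile p) (lam t) x)
      * scaled (2 / p - 1) (profilePrim p) (lam t) x = 0)
    (hphi : ∀ t ∈ I, ∫ x, (u t (x + y t) - scaled (2 / p) (profile p) (lam t) x)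
      * scaled (2 / p) (profile p) (lam t) x = 0)
    {t : ℝ} (ht : t ∈ I) {N : ℝ}
    (hN : N = ∫ x, scaled (2 / p) (profile p) (lam t) x * scaled (2 / p) (profile p) (lam t) x)
    {ξ η : ℝ → ℝ} (hξ : ξ = fun x => u t (x + y t) - scaled (2 / p) (profile p) (lam t) x)
    (hη : η = fun x => v t (x + y t) + lam t * scaled (2 / p) (profile p) (lam t) x) :
    (lam t - deriv y t) * N = (∫ x, η x * scaled (2 / p) (profile p) (lam t) x)
      - deriv lam t * (-lam t / (1 - lam t ^ 2)) *
        ∫ x, ξ x * scaled (2 / p - 1) (fun z => z * profile p z) (lam t) x ∧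
    deriv lam t * (-lam t / (1 - lam t ^ 2)) * ((2 / p - 1 / 2) * N
      - ∫ x, ξ x * scaled (2 / p) (fun z => z * profileDeriv p z) (lam t) x)
      = -(∫ x, η x * scaled (2 / p + 1) (profileDeriv p) (lam t) x)
        - deriv y t * ∫ x, ξ x * scaled (2 / p + 1) (profileDeriv p) (lam t) x := by
  have hS : ∀ s ∈ I, 0 < √(1 - lam s ^ 2) := fun s hs =>
    sqrt_one_sub_sq_pos (hrange s hs).1 (hrange s hs).2
  have hQc := continuous_profile hp
  have hQ'c := continuous_profileDeriv hp
  have hGc : Continuous (profilePrim p) :=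
    continuous_iff_continuousAt.2 fun x => (hasDerivAt_profilePrim hp x).continuousAt
  have mP : ∀ s ∈ I, MemLp (scaled (2 / p) (profile p) (lam s)) 2 := fun s hs =>
    memLp_scaled hQc (memLp_profile hp) _ (hS s hs)
  have mPd := memLp_scaled hQ'c (memLp_profileDeriv hp) (2 / p + 1) (hS t ht)
  have mxP : MemLp (scaled (2 / p - 1) (fun z => z * profile p z) (lam t)) 2 :=
    memLp_scaled (continuous_id.mul hQc) (memLp_id_mul_profile hp) _ (hS t ht)
  have mxPd : MemLp (scaled (2 / p) (fun z => z * profileDeriv p z) (lam t)) 2 :=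
    memLp_scaled (continuous_id.mul hQ'c) (memLp_id_mul_profileDeriv hp) _ (hS t ht)
  have hslice : ∀ s ∈ I, Continuous (fun x => u s (x + y s)) ∧
      Continuous (fun x => v s (x + y s)) := fun s hs =>
    ⟨(continuous_iff_continuousAt.2 fun x =>
      (differentiable_slices hI hu hs x).2.continuousAt).comp (by fun_prop),
     (continuous_iff_continuousAt.2 fun x =>
      (differentiable_slices hI hv hs x).2.continuousAt).comp (by fun_prop)⟩
  have mUV : ∀ s ∈ I, MemLp (fun x => u s (x + y s)) 2 ∧ MemLp (fun x => v s (x + y s)) 2 ∧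
      Integrable fun x => u s (x + y s) := by
    intro s hs
    obtain ⟨δ, hδ, g, hg, hg2, hb⟩ := hdom s hs
    have hb := hb s hs (by simpa using hδ)
    exact ⟨memLp_two_of_dominated (hslice s hs).1.aestronglyMeasurable (hg2.comp_add_right (y s))
        fun x => (hb _).1,
      memLp_two_of_dominated (hslice s hs).2.aestronglyMeasurable (hg2.comp_add_right (y s))
        fun x => (hb _).2.1,
      (hg.comp_add_right (y s)).mono' (hslice s hs).1.aestronglyMeasurable
        (ae_of_all _ fun x => (hb _).1)⟩
  obtain ⟨KG, hKG⟩ := exists_abs_profilePrim_le hp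
  obtain ⟨KQ, hKQ⟩ := exists_abs_profile_le hp
  have hF1 : ∀ s ∈ I, ∫ x, u s (x + y s) * scaled (2 / p - 1) (profilePrim p) (lam s) x = 0 := by
    intro s hs
    have iP : Integrable (scaled (2 / p) (profile p) (lam s)) :=
      ((integrable_profile hp).comp_mul_left' (hS s hs).ne').const_mul _
    have hbd : ∀ {f : ℝ → ℝ}, Integrable f →
        Integrable fun x => f x * scaled (2 / p - 1) (profilePrim p) (lam s) x := fun hf =>
      hf.mul_bdd (c := √(1 - lam s ^ 2) ^ (2 / p - 1) * KG)
        (continuous_scaled hGc _ _).aestronglyMeasurable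
        (ae_of_all _ fun x => abs_scaled_le hKG _ _ x)
    have hodd : ∫ x, scaled (2 / p) (profile p) (lam s) x *
        scaled (2 / p - 1) (profilePrim p) (lam s) x = 0 := by
      refine integral_eq_zero_of_odd fun x => ?_
      simp only [scaled, mul_neg, profile_neg, profilePrim_neg]
    have h := hgam s hs
    simp only [sub_mul] at h
    rw [integral_sub (hbd (mUV s hs).2.2) (hbd iP), hodd, sub_zero] at h
    exact h
  have hF2 : ∀ s ∈ I, ∫ x, u s (x + y s) * scaled (2 / p) (profile p) (lam s) x
      = scaled (2 / p + 2 / p - 1) (fun _ => ∫ x, profile p x * profile p x) (lam s) (0 - 0) := by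
    intro s hs
    have h := integral_mul_eq_add 1 (mUV s hs).1 (mP s hs) (mP s hs)
    simp only [one_mul] at h
    rw [h, hphi s hs, integral_scaled_mul_scaled _ _ _ _ (hS s hs), zero_add, scaled]
  have hNs := integral_scaled_mul_scaled (profile p) (profile p) (2 / p) (2 / p) (hS t ht)
  obtain ⟨δ, hδ, g, hg, -, hb⟩ := hdom t ht
  have d1 := hasDerivAt_integral_mul_scaled hI hu hv huv hlam hy hrange ht hδ hg hb
    (hasDerivAt_profilePrim hp) hQc (K := max KG KQ)
    (fun z => ⟨(hKG z).trans (le_max_left _ _), (hKQ z).1.trans (le_max_right _ _),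
      (hKQ z).2.trans (le_max_right _ _)⟩) (2 / p - 1)
  have d2 := hasDerivAt_integral_mul_scaled hI hu hv huv hlam hy hrange ht hδ hg hb
    (hasDerivAt_profile hp) hQ'c (K := KQ)
    (fun z => ⟨(hKQ z).1, (abs_profileDeriv_le hp z).trans ((le_abs_self _).trans (hKQ z).1), by
      refine le_trans ?_ (hKQ z).2
      rw [abs_mul, abs_mul]
      exact mul_le_mul_of_nonneg_left ((abs_profileDeriv_le hp z).trans (le_abs_self _))
        (abs_nonneg z)⟩) (2 / p)
  have hlamd := ((hlam.differentiableOn (by norm_num)).differentiableAt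
    (hI.mem_nhds ht)).hasDerivAt
  have z1 : HasDerivAt (fun s => ∫ x, u s (x + y s) *
      scaled (2 / p - 1) (profilePrim p) (lam s) x) 0 t := by
    refine (hasDerivAt_const t (0 : ℝ)).congr_of_eventuallyEq ?_
    filter_upwards [hI.mem_nhds ht] with s hs using hF1 s hs
  have ev : (fun s => ∫ x, u s (x + y s) * scaled (2 / p) (profile p) (lam s) x) =ᶠ[nhds t]
      fun s => scaled (2 / p + 2 / p - 1) (fun _ => ∫ x, profile p x * profile p x) (lam s)
        (0 - 0) := by
    filter_upwards [hI.mem_nhds ht] with s hs using hF2 s hs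
  have z2 := (hasDerivAt_scaled_transport (H := fun _ => ∫ x, profile p x * profile p x)
    (h := fun _ => 0) (fun z => hasDerivAt_const z _) (2 / p + 2 / p - 1) hlamd
    (hasDerivAt_const t (0 : ℝ)) (hrange t ht).1 (hrange t ht).2 0).congr_of_eventuallyEq ev
  have e1 := d1.unique z1
  have e2 := d2.unique z2
  have hUJ : ∀ {J : ℝ → ℝ}, MemLp J 2 → ∫ x, u t (x + y t) * J x
      = (∫ x, ξ x * J x) + ∫ x, scaled (2 / p) (profile p) (lam t) x * J x := fun hJ => by
    simpa only [one_mul, hξ] using integral_mul_eq_add 1 (mUV t ht).1 (mP t ht) hJ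
  have hVJ : ∀ {J : ℝ → ℝ}, MemLp J 2 → ∫ x, v t (x + y t) * J x
      = (∫ x, η x * J x) - lam t * ∫ x, scaled (2 / p) (profile p) (lam t) x * J x := fun hJ => by
    have h := integral_mul_eq_add (-lam t) (mUV t ht).2.1 (mP t ht) hJ
    simp only [neg_mul, sub_neg_eq_add, ← sub_eq_add_neg] at h
    rw [h, hη]
  have o1 : ∫ x, scaled (2 / p) (profile p) (lam t) x *
      scaled (2 / p - 1) (fun z => z * profile p z) (lam t) x = 0 := by
    refine integral_eq_zero_of_odd fun x => ?_
    simp only [scaled, mul_neg, profile_neg, neg_mul]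
  have o2 : ∫ x, scaled (2 / p) (profile p) (lam t) x *
      scaled (2 / p + 1) (profileDeriv p) (lam t) x = 0 := by
    refine integral_eq_zero_of_odd fun x => ?_
    simp only [scaled, mul_neg, profile_neg, profileDeriv_neg]
  have o3 : ∫ x, scaled (2 / p) (profile p) (lam t) x *
      scaled (2 / p) (fun z => z * profileDeriv p z) (lam t) x = -(1 / 2) * N := by
    rw [hN, integral_scaled_mul_scaled _ _ _ _ (hS t ht), hNs,
      integral_profile_mul_id_mul_profileDeriv hp]
    ring
  rw [hF1 t ht, sub_add_cancel, hVJ (mP t ht), hUJ mxP, hUJ (mP t ht), o1, ← hN] at e1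
  rw [hVJ mPd, hUJ (mP t ht), hUJ mxPd, hUJ mPd, o2, o3, ← hN] at e2
  have hξP : ∫ x, ξ x * scaled (2 / p) (profile p) (lam t) x = 0 := by
    rw [hξ]
    exact hphi t ht
  rw [hξP] at e1 e2
  have hsc : scaled (2 / p + 2 / p - 1) (fun _ => ∫ x, profile p x * profile p x) (lam t) (0 - 0)
      = N := by rw [hN, hNs, scaled]
  have hzero : scaled (2 / p + 2 / p - 1) (fun z => z * 0) (lam t) (0 - 0) = 0 := by
    simp [scaled]
  rw [hsc, hzero] at e2
  constructor
  · linear_combination e1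
  · linear_combination -e2

lemma exists_modulation_bounds {K N₀ D σ₀ σ₁ : ℝ} (hK : 0 < K) (hN₀ : 0 < N₀) (hD : 0 < D)
    (hσ₀ : 0 < σ₀) (hσ₁ : 0 < σ₁) :
    ∃ ε > 0, ∃ C > 0, ∀ n N l σ l' y' X₁ X₂ X₃ X₄ X₅ : ℝ, 0 ≤ n → n ≤ ε → N₀ ≤ N → |l| ≤ 1 →
      σ₀ ≤ |σ| → |σ| ≤ σ₁ → |X₁| ≤ K * n → |X₂| ≤ K * n → |X₃| ≤ K * n → |X₄| ≤ K * n →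
      |X₅| ≤ K * n → (l - y') * N = X₁ - l' * σ * X₄ →
      l' * σ * (D * N - X₅) = -X₂ - y' * X₃ →
      |l'| ≤ C * n ∧ |y' - l + N⁻¹ * X₁| ≤ C * n ^ 2 := by
  set C₁ : ℝ := (2 * K + K ^ 2 / N₀) * (4 / (σ₀ * D * N₀)) with hC₁
  have hC₁0 : 0 < C₁ := by positivity
  refine ⟨min 1 (min (D * N₀ / (2 * K)) (σ₀ * D * N₀ ^ 2 / (4 * σ₁ * K ^ 2))), by positivity,
    C₁ + C₁ * σ₁ * K / N₀, by positivity, ?_⟩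
  intro n N l σ l' y' X₁ X₂ X₃ X₄ X₅ hn hnε hN hl hs0 hs1 h1 h2 h3 h4 h5 e1 e2
  have hn1 : n ≤ 1 := hnε.trans (min_le_left _ _)
  have hn2 : K * n ≤ D * N₀ / 2 := by
    have := hnε.trans ((min_le_right _ _).trans (min_le_left _ _))
    rw [le_div_iff₀ (by positivity)] at this
    linarith
  have hn3 : σ₁ * K ^ 2 * n / N₀ ≤ σ₀ * D * N₀ / 4 := by
    have := hnε.trans ((min_le_right _ _).trans (min_le_right _ _))
    rw [le_div_iff₀ (by positivity)] at this
    rw [div_le_iff₀ hN₀]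
    linarith
  have hNpos : 0 < N := hN₀.trans_le hN
  have hKn : 0 ≤ K * n := by positivity
  have hdiff : y' - l + N⁻¹ * X₁ = l' * σ * X₄ / N := by
    field_simp
    linarith
  have hquot : |l' * σ * X₄ / N| ≤ |l'| * (σ₁ * (K * n) / N₀) := by
    rw [abs_div, abs_mul, abs_mul, abs_of_pos hNpos, mul_assoc, mul_div_assoc]
    gcongr
  have hX1 : |N⁻¹ * X₁| ≤ K * n / N₀ := by
    rw [abs_mul, abs_inv, abs_of_pos hNpos, inv_mul_eq_div]
    gcongr
  have hy' : |y'| ≤ 1 + K * n / N₀ + |l'| * (σ₁ * (K * n) / N₀) := by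
    have : y' = l - N⁻¹ * X₁ + l' * σ * X₄ / N := by linarith
    rw [this]
    refine (abs_add_le _ _).trans (add_le_add ((abs_sub _ _).trans (add_le_add hl hX1)) hquot)
  have hlow : |l'| * (σ₀ * (D * N₀ / 2)) ≤ |l' * σ * (D * N - X₅)| := by
    rw [abs_mul, abs_mul, mul_assoc]
    have : D * N₀ / 2 ≤ |D * N - X₅| := by
      refine le_trans ?_ (le_abs_self _)
      have := (le_abs_self X₅).trans h5
      have := mul_le_mul_of_nonneg_left hN hD.le
      linarith
    gcongr
  have hup : |l' * σ * (D * N - X₅)| ≤ K * n + |y'| * (K * n) := by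
    rw [e2]
    refine (abs_sub _ _).trans (add_le_add (by rwa [abs_neg]) ?_)
    rw [abs_mul]
    gcongr
  have hmul : |y'| * (K * n) ≤ K * n + K ^ 2 / N₀ * n + |l'| * (σ₀ * D * N₀ / 4) := by
    calc |y'| * (K * n) ≤ (1 + K * n / N₀ + |l'| * (σ₁ * (K * n) / N₀)) * (K * n) := by gcongr
      _ = K * n + K ^ 2 / N₀ * n * n + |l'| * (σ₁ * K ^ 2 * n / N₀ * n) := by ring
      _ ≤ K * n + K ^ 2 / N₀ * n * 1 + |l'| * (σ₀ * D * N₀ / 4 * 1) := by gcongr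
      _ = _ := by ring
  have hl' : |l'| ≤ C₁ * n := by
    have h : |l'| * (σ₀ * D * N₀ / 4) ≤ (2 * K + K ^ 2 / N₀) * n := by linarith
    rw [← le_div_iff₀ (by positivity)] at h
    refine h.trans (le_of_eq ?_)
    rw [hC₁]
    field_simp
  refine ⟨hl'.trans ?_, ?_⟩
  · have : 0 ≤ C₁ * σ₁ * K / N₀ := by positivity
    nlinarith
  · rw [hdiff]
    calc |l' * σ * X₄ / N| ≤ |l'| * (σ₁ * (K * n) / N₀) := hquot
      _ ≤ C₁ * n * (σ₁ * (K * n) / N₀) := by gcongr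
      _ = C₁ * σ₁ * K / N₀ * n ^ 2 := by ring
      _ ≤ _ := by
        gcongr
        linarith

/-- Dynamics of the modulation parameters at the critical frequency
`ω² = p/4`: along any solution of the generalized Boussinesq system with
`C¹` modulation parameters `λ(t), y(t)` satisfying the orthogonality
conditions and the smallness condition, one has
`|λ̇| ≤ C‖(ξ,η)‖` and
`|ẏ - λ + ‖φ_λ‖⁻²∫ηφ_λ| ≤ C(‖(ξ,η)‖² + |λ-ω|‖(ξ,η)‖)`. -/
theorem parameter_dynamics (p ω : ℝ) (hp : 0 < p) (hp4 : p < 4)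
    (hω1 : -1 < ω) (hω2 : ω < 1) (hcrit : ω ^ 2 = p / 4) :
    ∃ ε > 0, ∃ C > 0,
      ∀ (I : Set ℝ), IsOpen I → I.OrdConnected →
      ∀ (u v : ℝ → ℝ → ℝ) (lam y : ℝ → ℝ),
      ContDiffOn ℝ 1 (fun q : ℝ × ℝ => u q.1 q.2) (I ×ˢ Set.univ) →
      ContDiffOn ℝ 1 (fun q : ℝ × ℝ => v q.1 q.2) (I ×ˢ Set.univ) →
      (∀ t ∈ I, ContDiff ℝ 3 (u t)) →
      (∀ t ∈ I, ∀ x : ℝ, deriv (fun s => u s x) t = deriv (v t) x) →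
      (∀ t ∈ I, ∀ x : ℝ,
        deriv (fun s => v s x) t
          = deriv (fun x' => -(deriv (deriv (u t)) x') + u t x'
              - |u t x'| ^ p * u t x') x) →
      (∀ t₀ ∈ I, ∃ δ > 0, ∃ g : ℝ → ℝ,
        Integrable g ∧ Integrable (fun x => (g x) ^ 2) ∧
        ∀ t ∈ I, |t - t₀| < δ → ∀ x : ℝ,
          |u t x| ≤ g x ∧ |v t x| ≤ g x ∧ |deriv (u t) x| ≤ g x ∧
          |deriv (deriv (u t)) x| ≤ g x ∧
          |deriv (deriv (deriv (u t))) x| ≤ g x ∧ |deriv (v t) x| ≤ g x) →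
      ContDiffOn ℝ 1 lam I → ContDiffOn ℝ 1 y I →
      (∀ t ∈ I, -1 < lam t ∧ lam t < 1) →
      (∀ t ∈ I,
        (∫ x : ℝ, (u t (x + y t) - phi p (lam t) x) * gam p (lam t) x) = 0) →
      (∀ t ∈ I,
        (∫ x : ℝ, (u t (x + y t) - phi p (lam t) x) * phi p (lam t) x) = 0) →
      (∀ t ∈ I,
        pairNorm (fun x => u t (x + y t) - phi p (lam t) x)
            (fun x => v t (x + y t) + lam t * phi p (lam t) x)
          + |lam t - ω| ≤ ε) →
      ∀ t ∈ I,
        |deriv lam t| ≤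
          C * pairNorm (fun x => u t (x + y t) - phi p (lam t) x)
            (fun x => v t (x + y t) + lam t * phi p (lam t) x) ∧
        |deriv y t - lam t + (∫ x : ℝ, (phi p (lam t) x) ^ 2)⁻¹ *
            ∫ x : ℝ, (v t (x + y t) + lam t * phi p (lam t) x) * phi p (lam t) x|
          ≤ C * ((pairNorm (fun x => u t (x + y t) - phi p (lam t) x)
                (fun x => v t (x + y t) + lam t * phi p (lam t) x)) ^ 2
              + |lam t - ω| *
                pairNorm (fun x => u t (x + y t) - phi p (lam t) x)
                  (fun x => v t (x + y t) + lam t * phi p (lam t) x)) := by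
  have hω0 : 0 < |ω| := abs_pos.2 fun h => by
    rw [h] at hcrit
    linarith
  have hω1' : |ω| < 1 := abs_lt.2 ⟨hω1, hω2⟩
  have ha2 : 0 < 1 - ((1 + |ω|) / 2) ^ 2 := by nlinarith
  have ha := Real.sqrt_pos.2 ha2
  set a : ℝ := √(1 - ((1 + |ω|) / 2) ^ 2)
  have hQc := continuous_profile hp
  have hQ'c := continuous_profileDeriv hp
  obtain ⟨K₁, hK₁, hb₁⟩ := exists_abs_integral_mul_scaled_le hQc (memLp_profile hp) (2 / p) ha
  obtain ⟨K₂, hK₂, hb₂⟩ :=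
    exists_abs_integral_mul_scaled_le hQ'c (memLp_profileDeriv hp) (2 / p + 1) ha
  obtain ⟨K₃, hK₃, hb₃⟩ := exists_abs_integral_mul_scaled_le
    (H := fun z => z * profile p z) (continuous_id.mul hQc) (memLp_id_mul_profile hp)
    (2 / p - 1) ha
  obtain ⟨K₄, hK₄, hb₄⟩ := exists_abs_integral_mul_scaled_le
    (H := fun z => z * profileDeriv p z) (continuous_id.mul hQ'c)
    (memLp_id_mul_profileDeriv hp) (2 / p) ha
  have hD : 0 < 2 / p - 1 / 2 := by
    rw [sub_pos, div_lt_div_iff₀ two_pos hp]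
    linarith
  obtain ⟨ε, hε, C, hC, hmain⟩ := exists_modulation_bounds
    (K := K₁ + K₂ + K₃ + K₄ + 1)
    (N₀ := a ^ |2 / p + 2 / p - 1| * ∫ x, profile p x * profile p x)
    (D := 2 / p - 1 / 2) (σ₀ := |ω| / 2) (σ₁ := (1 - ((1 + |ω|) / 2) ^ 2)⁻¹)
    (by positivity) (mul_pos (by positivity) (integral_profile_mul_self_pos hp)) hD
    (by positivity) (by positivity)
  refine ⟨min ε (min (|ω| / 2) ((1 - |ω|) / 2)),
    lt_min hε (lt_min (by positivity) (by linarith)), C, hC, ?_⟩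
  intro I hI _ u v lam y hu hv hu3 huv _ hdom hlam hy hrange hgam hphi hsmall t ht
  have hl1 := (hrange t ht).1
  have hl2 := (hrange t ht).2
  have hS := sqrt_one_sub_sq_pos hl1 hl2
  have hgam' : ∀ t ∈ I, ∫ x, (u t (x + y t) - scaled (2 / p) (profile p) (lam t) x)
      * scaled (2 / p - 1) (profilePrim p) (lam t) x = 0 := fun s hs => by
    rw [← phi_eq_scaled hp (hrange s hs).1 (hrange s hs).2,
      ← gam_eq_scaled hp (hrange s hs).1 (hrange s hs).2]
    exact hgam s hs
  have hphi' : ∀ t ∈ I, ∫ x, (u t (x + y t) - scaled (2 / p) (profile p) (lam t) x)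
      * scaled (2 / p) (profile p) (lam t) x = 0 := fun s hs => by
    rw [← phi_eq_scaled hp (hrange s hs).1 (hrange s hs).2]
    exact hphi s hs
  have hdom' : ∀ t₀ ∈ I, ∃ δ > 0, ∃ g : ℝ → ℝ, Integrable g ∧ Integrable (fun x => g x ^ 2) ∧
      ∀ t ∈ I, |t - t₀| < δ → ∀ x,
        |u t x| ≤ g x ∧ |v t x| ≤ g x ∧ |deriv (v t) x| ≤ g x := fun t₀ ht₀ => by
    obtain ⟨δ, hδ, g, hg, hg2, h⟩ := hdom t₀ ht₀
    exact ⟨δ, hδ, g, hg, hg2, fun s hs hst x =>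
      ⟨(h s hs hst x).1, (h s hs hst x).2.1, (h s hs hst x).2.2.2.2.2⟩⟩
  have hsm := hsmall t ht
  rw [phi_eq_scaled hp hl1 hl2] at hsm ⊢
  set P := scaled (2 / p) (profile p) (lam t) with hP
  set ξ : ℝ → ℝ := fun x => u t (x + y t) - P x with hξ
  set η : ℝ → ℝ := fun x => v t (x + y t) + lam t * P x with hη
  set n := pairNorm ξ η with hn
  obtain ⟨e1, e2⟩ := modulation_equations hp hI hu hv huv hdom' hlam hy hrange hgam' hphi' ht
    (N := ∫ x, P x * P x) rfl (ξ := ξ) (η := η) rfl rfl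
  have mP : MemLp P 2 := memLp_scaled hQc (memLp_profile hp) _ hS
  have mPd : MemLp (scaled (2 / p + 1) (profileDeriv p) (lam t)) 2 :=
    memLp_scaled hQ'c (memLp_profileDeriv hp) _ hS
  have hud : ∀ x, HasDerivAt (u t) (deriv (u t) x) x := fun x =>
    (differentiable_slices hI hu ht x).2.hasDerivAt
  obtain ⟨δ, hδ, g, -, hg2, hb⟩ := hdom t ht
  have hb := hb t ht (by simpa using hδ)
  have hg2' := hg2.comp_add_right (y t)
  have mξ : MemLp ξ 2 := (memLp_two_of_dominated (f := fun x => u t (x + y t))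
    ((hu3 t ht).continuous.comp (continuous_add_const (y t))).aestronglyMeasurable hg2'
    fun x => (hb (x + y t)).1).sub mP
  have mη : MemLp η 2 := (memLp_two_of_dominated (f := fun x => v t (x + y t))
    ((continuous_iff_continuousAt.2 fun x => (differentiable_slices hI hv ht x).2.continuousAt).comp
      (continuous_add_const (y t))).aestronglyMeasurable hg2'
    fun x => (hb (x + y t)).2.1).add (mP.const_mul (lam t))
  have hξd : deriv ξ = fun x => deriv (u t) (x + y t)
      - scaled (2 / p + 1) (profileDeriv p) (lam t) x := by
    ext x
    exact (((hud (x + y t)).comp_add_const x (y t)).sub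
      (hasDerivAt_scaled (hasDerivAt_profile hp) (2 / p) hS x)).deriv
  have mξd : MemLp (deriv ξ) 2 := by
    rw [hξd]
    exact (memLp_two_of_dominated (f := fun x => deriv (u t) (x + y t))
      ((measurable_deriv (u t)).comp (measurable_add_const (y t))).aestronglyMeasurable hg2'
      fun x => (hb (x + y t)).2.2.1).sub mPd
  have iξ := mξ.integrable_sq
  have iη := mη.integrable_sq
  have iξd := mξd.integrable_sq
  have hle : √(∫ x, ξ x * ξ x) ≤ n ∧ √(∫ x, η x * η x) ≤ n := by
    constructor <;>
    · refine Real.sqrt_le_sqrt (integral_mono ?_ ((iξd.add iξ).add iη) fun x => ?_)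
      · simpa only [← sq]
      · simp only
        nlinarith [sq_nonneg (deriv ξ x), sq_nonneg (ξ x), sq_nonneg (η x)]
  have hn0 : 0 ≤ n := Real.sqrt_nonneg _
  have hdist : |lam t - ω| ≤ min (|ω| / 2) ((1 - |ω|) / 2) := by
    have := hsm.trans (min_le_right _ _)
    linarith
  have hd1 : |ω| / 2 ≤ |lam t| := by
    have h1 := hdist.trans (min_le_left _ _)
    have h2 := abs_sub_abs_le_abs_sub ω (lam t)
    rw [abs_sub_comm] at h2
    linarith
  have hd2 : |lam t| ≤ (1 + |ω|) / 2 := by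
    have h1 := hdist.trans (min_le_right _ _)
    have h2 := abs_sub_abs_le_abs_sub (lam t) ω
    linarith
  have hsq : 1 - ((1 + |ω|) / 2) ^ 2 ≤ 1 - lam t ^ 2 := by
    have : |lam t| ^ 2 ≤ ((1 + |ω|) / 2) ^ 2 := by gcongr
    rw [sq_abs] at this
    linarith
  have hal : a ≤ √(1 - lam t ^ 2) := Real.sqrt_le_sqrt hsq
  have h0 : 0 < 1 - lam t ^ 2 := ha2.trans_le hsq
  have hN : a ^ |2 / p + 2 / p - 1| * ∫ x, profile p x * profile p x ≤ ∫ x, P x * P x := by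
    rw [hP, integral_scaled_mul_scaled _ _ _ _ hS]
    gcongr
    · exact (integral_profile_mul_self_pos hp).le
    · exact rpow_abs_le_rpow ha hal (Real.sqrt_le_one.2 (by nlinarith [sq_nonneg (lam t)])) _
  have hl : |lam t| ≤ 1 := abs_le.2 ⟨hl1.le, hl2.le⟩
  have hσ : |-lam t / (1 - lam t ^ 2)| = |lam t| * (1 - lam t ^ 2)⁻¹ := by
    rw [abs_div, abs_neg, abs_of_pos h0, div_eq_mul_inv]
  have hσ0 : |ω| / 2 ≤ |-lam t / (1 - lam t ^ 2)| := by
    rw [hσ]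
    refine hd1.trans (le_mul_of_one_le_right (abs_nonneg _) ((one_le_inv₀ h0).2 ?_))
    linarith [sq_nonneg (lam t)]
  have hσ1 : |-lam t / (1 - lam t ^ 2)| ≤ (1 - ((1 + |ω|) / 2) ^ 2)⁻¹ := by
    rw [hσ]
    exact (mul_le_of_le_one_left (by positivity) hl).trans (by gcongr)
  have hbound : ∀ {X K r : ℝ}, |X| ≤ K * r → r ≤ n → 0 ≤ K → K ≤ K₁ + K₂ + K₃ + K₄ + 1 →
      |X| ≤ (K₁ + K₂ + K₃ + K₄ + 1) * n := fun h1 h2 h3 h4 =>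
    h1.trans ((mul_le_mul_of_nonneg_left h2 h3).trans (mul_le_mul_of_nonneg_right h4 hn0))
  obtain ⟨c1, c2⟩ := hmain n (∫ x, P x * P x) (lam t) (-lam t / (1 - lam t ^ 2))
    (deriv lam t) (deriv y t) _ _ _ _ _ hn0
    ((le_add_of_nonneg_right (abs_nonneg _)).trans (hsm.trans (min_le_left _ _))) hN hl hσ0 hσ1
    (hbound (hb₁ (lam t) hal η mη) hle.2 hK₁ (by linarith))
    (hbound (hb₂ (lam t) hal η mη) hle.2 hK₂ (by linarith))
    (hbound (hb₂ (lam t) hal ξ mξ) hle.1 hK₂ (by linarith))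
    (hbound (hb₃ (lam t) hal ξ mξ) hle.1 hK₃ (by linarith))
    (hbound (hb₄ (lam t) hal ξ mξ) hle.1 hK₄ (by linarith)) e1 e2
  refine ⟨c1, ?_⟩
  simp only [sq (P _)]
  refine c2.trans (mul_le_mul_of_nonneg_left ?_ hC.le)
  exact le_add_of_nonneg_right (mul_nonneg (abs_nonneg _) hn0)
end

section
/- Let 0 < p < 4 and ω² = p/4 with ω ∈ (−1,1). Define, for a > 0 and λ ∈ (−1,1), ρ(a,λ) = −2·(4/p + 1)·( E((1+a)Φ_ω) − E(Φ_ω) ) − 2λ·(2(4−p)/p + 1)·( Q((1+a)Φ_ω) − Q(Φ_ω) ) + 2·(∫_ℝ φ_λ² dx)^{−1}·Q((1+a)Φ_ω)·( Q((1+a)Φ_ω) − Q(Φ_ω) ). Then there exist constants C₁ > 0, a₀ > 0 and ε₁ > 0 such that for all a ∈ (0, a₀) and all λ ∈ (−1,1) with |λ − ω| ≤ ε₁, one has ρ(a,λ) ≥ C₁·a. -/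
open MeasureTheory Real Filter

/-- Momentum `Q(u,v) = ∫ u v`. -/
noncomputable def Qm (u v : ℝ → ℝ) : ℝ := ∫ x : ℝ, u x * v x

/-- Energy `E(u,v) = ½∫((∂ₓu)² + u² + v²) - (1/(p+2))∫|u|^{p+2}`. -/
noncomputable def En (p : ℝ) (u v : ℝ → ℝ) : ℝ :=
  (1 / 2) * (∫ x : ℝ, ((deriv u x) ^ 2 + (u x) ^ 2 + (v x) ^ 2))
    - (1 / (p + 2)) * ∫ x : ℝ, |u x| ^ (p + 2)

/-- The quantity `ρ(a,λ)` evaluated at initial data `(1+a)Φ_ω`. -/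
noncomputable def rho (p ω a l : ℝ) : ℝ :=
  -2 * (4 / p + 1) *
      (En p (fun x => (1 + a) * phi p ω x) (fun x => -(1 + a) * ω * phi p ω x)
        - En p (phi p ω) (fun x => -ω * phi p ω x))
    - 2 * l * (2 * (4 - p) / p + 1) *
      (Qm (fun x => (1 + a) * phi p ω x) (fun x => -(1 + a) * ω * phi p ω x)
        - Qm (phi p ω) (fun x => -ω * phi p ω x))
    + 2 * (∫ x : ℝ, (phi p l x) ^ 2)⁻¹ *
      Qm (fun x => (1 + a) * phi p ω x) (fun x => -(1 + a) * ω * phi p ω x) *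
      (Qm (fun x => (1 + a) * phi p ω x) (fun x => -(1 + a) * ω * phi p ω x)
        - Qm (phi p ω) (fun x => -ω * phi p ω x))

theorem integrable_cosh_rpow_neg {r : ℝ} (hr : 0 < r) :
    Integrable fun x : ℝ => cosh x ^ (-r) := by
  have hcont : Continuous fun x : ℝ => cosh x ^ (-r) :=
    continuous_cosh.rpow_const fun x => Or.inl (cosh_pos x).ne'
  have bound (x t : ℝ) (h : exp t / 2 ≤ cosh x) :
      ‖cosh x ^ (-r)‖ ≤ exp (-r * t) * (1 / 2) ^ (-r) := by
    rw [norm_of_nonneg (rpow_nonneg (cosh_pos x).le _)]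
    refine (rpow_le_rpow_of_nonpos (by positivity) h (by linarith)).trans_eq ?_
    rw [div_eq_mul_one_div, mul_rpow (exp_pos t).le (by norm_num), ← exp_mul, mul_comm t]
  rw [← integrableOn_univ, ← Set.Iic_union_Ioi (a := (0 : ℝ))]
  refine IntegrableOn.union ?_ ?_
  · refine Integrable.mono' ((integrableOn_exp_mul_Iic hr 0).mul_const ((1 / 2) ^ (-r)))
      hcont.aestronglyMeasurable (ae_of_all _ fun x => ?_)
    have := bound x (-x) (by rw [cosh_eq]; linarith [exp_pos x])
    simpa using this
  · refine Integrable.mono' ((integrableOn_exp_mul_Ioi (neg_lt_zero.mpr hr) 0).mul_const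
      ((1 / 2) ^ (-r))) hcont.aestronglyMeasurable (ae_of_all _ fun x => ?_)
    exact bound x x (by rw [cosh_eq]; linarith [exp_pos (-x)])

theorem integral_cosh_rpow_neg_pos {r : ℝ} (hr : 0 < r) :
    0 < ∫ x : ℝ, cosh x ^ (-r) :=
  integral_pos_of_integrable_nonneg_nonzero
    (continuous_cosh.rpow_const fun x => Or.inl (cosh_pos x).ne')
    (integrable_cosh_rpow_neg hr) (fun x => rpow_nonneg (cosh_pos x).le _)
    (x := 0) (rpow_pos_of_pos (cosh_pos 0) _).ne'

/-- Reduction formula for the integrals of negative powers of `cosh`. -/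
theorem integral_cosh_rpow_neg_add_two {r : ℝ} (hr : 0 < r) :
    (r + 1) * ∫ x : ℝ, cosh x ^ (-(r + 2)) = r * ∫ x : ℝ, cosh x ^ (-r) := by
  have hi := integrable_cosh_rpow_neg hr
  have hi2 := integrable_cosh_rpow_neg (r := r + 2) (by linarith)
  have hderiv (x : ℝ) : HasDerivAt (fun y => sinh y * cosh y ^ (-(r + 1)))
      ((r + 1) * cosh x ^ (-(r + 2)) - r * cosh x ^ (-r)) x := by
    have hc := cosh_pos x
    refine ((hasDerivAt_sinh x).mul
      ((hasDerivAt_cosh x).rpow_const (p := -(r + 1)) (Or.inl hc.ne'))).congr_deriv ?_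
    have h1 : cosh x ^ (-(r + 1)) = cosh x ^ (-(r + 2)) * cosh x := by
      rw [← rpow_add_one hc.ne']; ring_nf
    have h2 : cosh x ^ (-r) = cosh x ^ (-(r + 2)) * cosh x ^ 2 := by
      rw [← rpow_add_natCast hc.ne']; push_cast; ring_nf
    rw [h1, h2, show -(r + 1) - 1 = -(r + 2) by ring]
    linear_combination (-(r + 1) * cosh x ^ (-(r + 2))) * sinh_sq x
  have hint : Integrable fun x : ℝ => sinh x * cosh x ^ (-(r + 1)) := by
    refine hi.mono' ?_ (ae_of_all _ fun x => ?_)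
    · exact (continuous_sinh.mul (continuous_cosh.rpow_const
        fun x => Or.inl (cosh_pos x).ne')).aestronglyMeasurable
    · have hc := cosh_pos x
      have hs : |sinh x| ≤ cosh x := by
        rw [abs_sinh, ← cosh_abs]; exact (sinh_lt_cosh _).le
      have h1 : cosh x ^ (-r) = cosh x * cosh x ^ (-(r + 1)) := by
        rw [mul_comm, ← rpow_add_one hc.ne']; ring_nf
      rw [norm_mul, norm_of_nonneg (rpow_nonneg hc.le _), h1, norm_eq_abs]
      gcongr
  have h := integral_eq_zero_of_hasDerivAt_of_integrable hderiv
    ((hi2.const_mul _).sub (hi.const_mul _)) hint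
  rw [integral_sub (hi2.const_mul _) (hi.const_mul _), integral_const_mul,
    integral_const_mul] at h
  linarith

theorem phi_sq {p l : ℝ} (hl : 0 < 1 - l ^ 2) (hp : 0 < p) (x : ℝ) :
    phi p l x ^ 2 = ((p + 2) * (1 - l ^ 2) / 2) ^ (2 / p) *
      cosh (p / 2 * √(1 - l ^ 2) * x) ^ (-(4 / p)) := by
  rw [phi, mul_pow, ← rpow_mul_natCast (by positivity),
    ← rpow_mul_natCast (cosh_pos _).le]
  congr 2 <;> push_cast <;> ring

theorem abs_phi_rpow {p l : ℝ} (hl : 0 < 1 - l ^ 2) (hp : 0 < p) (x : ℝ) :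
    |phi p l x| ^ (p + 2) = ((p + 2) * (1 - l ^ 2) / 2) ^ (2 / p) *
      ((p + 2) * (1 - l ^ 2) / 2) * cosh (p / 2 * √(1 - l ^ 2) * x) ^ (-(4 / p + 2)) := by
  have hA : 0 < (p + 2) * (1 - l ^ 2) / 2 := by positivity
  have hc := cosh_pos (p / 2 * √(1 - l ^ 2) * x)
  rw [phi, abs_of_nonneg (by positivity), mul_rpow (by positivity) (by positivity),
    ← rpow_mul hA.le, ← rpow_mul hc.le, ← rpow_add_one hA.ne']
  congr 2 <;> field_simp <;> ring

theorem hasDerivAt_phi (p l x : ℝ) :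
    HasDerivAt (phi p l) (((p + 2) * (1 - l ^ 2) / 2) ^ (1 / p) *
      (sinh (p / 2 * √(1 - l ^ 2) * x) * (p / 2 * √(1 - l ^ 2)) * (-(2 / p)) *
        cosh (p / 2 * √(1 - l ^ 2) * x) ^ (-(2 / p) - 1))) x := by
  refine HasDerivAt.const_mul _ (HasDerivAt.rpow_const ?_ (Or.inl (cosh_pos _).ne'))
  simpa using ((hasDerivAt_id x).const_mul (p / 2 * √(1 - l ^ 2))).cosh

theorem deriv_phi_sq {p l : ℝ} (hl : 0 < 1 - l ^ 2) (hp : 0 < p) (x : ℝ) :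
    deriv (phi p l) x ^ 2 = ((p + 2) * (1 - l ^ 2) / 2) ^ (2 / p) * (1 - l ^ 2) *
      (cosh (p / 2 * √(1 - l ^ 2) * x) ^ (-(4 / p)) -
        cosh (p / 2 * √(1 - l ^ 2) * x) ^ (-(4 / p + 2))) := by
  rw [(hasDerivAt_phi p l x).deriv]
  have hA : 0 < (p + 2) * (1 - l ^ 2) / 2 := by positivity
  have hs : √(1 - l ^ 2) ^ 2 = 1 - l ^ 2 := sq_sqrt hl.le
  set y := p / 2 * √(1 - l ^ 2) * x
  have hc := cosh_pos y
  have h1 : (((p + 2) * (1 - l ^ 2) / 2) ^ (1 / p)) ^ 2 =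
      ((p + 2) * (1 - l ^ 2) / 2) ^ (2 / p) := by
    rw [← rpow_mul_natCast hA.le]; congr 1; push_cast; ring
  have h2 : (cosh y ^ (-(2 / p) - 1)) ^ 2 = cosh y ^ (-(4 / p + 2)) := by
    rw [← rpow_mul_natCast hc.le]; congr 1; push_cast; ring
  have h3 : cosh y ^ (-(4 / p)) = cosh y ^ (-(4 / p + 2)) * cosh y ^ 2 := by
    rw [← rpow_add_natCast hc.ne']; push_cast; ring_nf
  rw [h3, ← h1, ← h2]
  have h4 : p / 2 * √(1 - l ^ 2) * (-(2 / p)) = -√(1 - l ^ 2) := by field_simp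
  rw [mul_assoc (sinh y), h4]
  generalize cosh y ^ (-(2 / p) - 1) = c at *
  generalize ((p + 2) * (1 - l ^ 2) / 2) ^ (1 / p) = A at *
  linear_combination A ^ 2 * c ^ 2 * sinh y ^ 2 * hs + A ^ 2 * c ^ 2 * (1 - l ^ 2) * sinh_sq y

theorem integral_phi_sq {p l : ℝ} (hl : 0 < 1 - l ^ 2) (hp : 0 < p) :
    ∫ x : ℝ, phi p l x ^ 2 = ((p + 2) * (1 - l ^ 2) / 2) ^ (2 / p) *
      ((p / 2 * √(1 - l ^ 2))⁻¹ * ∫ x : ℝ, cosh x ^ (-(4 / p))) := by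
  simp_rw [phi_sq hl hp]
  rw [integral_const_mul,
    Measure.integral_comp_mul_left (fun y : ℝ => cosh y ^ (-(4 / p))) (p / 2 * √(1 - l ^ 2)),
    abs_of_nonneg (by positivity), smul_eq_mul]

theorem integral_phi_sq_pos {p l : ℝ} (hl : 0 < 1 - l ^ 2) (hp : 0 < p) :
    0 < ∫ x : ℝ, phi p l x ^ 2 := by
  rw [integral_phi_sq hl hp]
  have := integral_cosh_rpow_neg_pos (r := 4 / p) (by positivity)
  positivity

theorem continuousAt_integral_phi_sq {p l : ℝ} (hl : 0 < 1 - l ^ 2) (hp : 0 < p) :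
    ContinuousAt (fun k => ∫ x : ℝ, phi p k x ^ 2) l := by
  have hcont : Continuous fun k : ℝ => 1 - k ^ 2 := by fun_prop
  have hev : ∀ᶠ k in nhds l, 0 < 1 - k ^ 2 := hcont.continuousAt.eventually (lt_mem_nhds hl)
  refine ContinuousAt.congr ?_ (hev.mono fun k hk => (integral_phi_sq hk hp).symm)
  refine ContinuousAt.mul (ContinuousAt.rpow_const (by fun_prop) (Or.inl (by positivity))) ?_
  exact (ContinuousAt.inv₀ (by fun_prop) (by positivity)).mul continuousAt_const

/-- The stationary equation tested against `φ`, combined with the mass: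
`∫ (φ'² + (1 + ω²) φ²) - ∫ φ^{p+2} = 2 ω² ∫ φ²`. -/
theorem integral_energy_density_sub {p ω : ℝ} (hl : 0 < 1 - ω ^ 2) (hp : 0 < p) :
    (∫ x : ℝ, (deriv (phi p ω) x ^ 2 + phi p ω x ^ 2 + (-ω * phi p ω x) ^ 2)) -
      ∫ x : ℝ, |phi p ω x| ^ (p + 2) = 2 * ω ^ 2 * ∫ x : ℝ, phi p ω x ^ 2 := by
  have hr : 0 < 4 / p := by positivity
  have hb : 0 < p / 2 * √(1 - ω ^ 2) := by positivity
  have hi := (integrable_cosh_rpow_neg hr).comp_mul_left' hb.ne'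
  have hi2 := (integrable_cosh_rpow_neg (r := 4 / p + 2) (by positivity)).comp_mul_left' hb.ne'
  have hred := integral_cosh_rpow_neg_add_two hr
  simp_rw [mul_pow, abs_phi_rpow hl hp, deriv_phi_sq hl hp, integral_phi_sq hl hp, phi_sq hl hp]
  set b := p / 2 * √(1 - ω ^ 2)
  set A := ((p + 2) * (1 - ω ^ 2) / 2) ^ (2 / p)
  have hS : (fun x => A * (1 - ω ^ 2) * (cosh (b * x) ^ (-(4 / p)) -
      cosh (b * x) ^ (-(4 / p + 2))) + A * cosh (b * x) ^ (-(4 / p)) +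
      (-ω) ^ 2 * (A * cosh (b * x) ^ (-(4 / p)))) =
      fun x => 2 * A * cosh (b * x) ^ (-(4 / p)) -
        A * (1 - ω ^ 2) * cosh (b * x) ^ (-(4 / p + 2)) := by
    funext x; ring
  rw [hS, integral_sub (hi.const_mul _) (hi2.const_mul _), integral_const_mul,
    integral_const_mul, integral_const_mul,
    Measure.integral_comp_mul_left (fun y : ℝ => cosh y ^ (-(4 / p))) b,
    Measure.integral_comp_mul_left (fun y : ℝ => cosh y ^ (-(4 / p + 2))) b,
    abs_of_nonneg (by positivity), smul_eq_mul, smul_eq_mul]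
  generalize (∫ x : ℝ, cosh x ^ (-(4 / p))) = I at *
  generalize (∫ x : ℝ, cosh x ^ (-(4 / p + 2))) = J at *
  have hJ : (p + 4) * J = 4 * I := by
    field_simp at hred; linarith
  linear_combination (-A * (1 - ω ^ 2) / 2 * b⁻¹) * hJ

theorem Qm_scaled_phi (p ω a : ℝ) :
    Qm (fun x => (1 + a) * phi p ω x) (fun x => -(1 + a) * ω * phi p ω x) =
      -(1 + a) ^ 2 * ω * ∫ x : ℝ, phi p ω x ^ 2 := by
  rw [Qm, ← integral_const_mul]
  congr 1; funext x; ring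

theorem Qm_phi (p ω : ℝ) :
    Qm (phi p ω) (fun x => -ω * phi p ω x) = -ω * ∫ x : ℝ, phi p ω x ^ 2 := by
  simpa using Qm_scaled_phi p ω 0

theorem En_scaled_phi (p ω : ℝ) {a : ℝ} (ha : 0 ≤ a) :
    En p (fun x => (1 + a) * phi p ω x) (fun x => -(1 + a) * ω * phi p ω x) =
      1 / 2 * ((1 + a) ^ 2 *
        ∫ x : ℝ, (deriv (phi p ω) x ^ 2 + phi p ω x ^ 2 + (-ω * phi p ω x) ^ 2)) -
      1 / (p + 2) * ((1 + a) ^ (p + 2) * ∫ x : ℝ, |phi p ω x| ^ (p + 2)) := by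
  rw [En, ← integral_const_mul ((1 + a) ^ 2), ← integral_const_mul ((1 + a) ^ (p + 2))]
  congr 3
  · funext x
    rw [deriv_const_mul _ (hasDerivAt_phi p ω x).differentiableAt]
    ring
  · funext x
    rw [abs_mul, abs_of_nonneg (by linarith : 0 ≤ 1 + a),
      mul_rpow (by linarith) (abs_nonneg _)]

theorem En_scaled_phi_sub_le {p ω a : ℝ} (hl : 0 < 1 - ω ^ 2) (hp : 0 < p) (ha : 0 ≤ a) :
    En p (fun x => (1 + a) * phi p ω x) (fun x => -(1 + a) * ω * phi p ω x) -
      En p (phi p ω) (fun x => -ω * phi p ω x) ≤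
      a * (2 * ω ^ 2 * ∫ x : ℝ, phi p ω x ^ 2) + a ^ 2 / 2 *
        ∫ x : ℝ, (deriv (phi p ω) x ^ 2 + phi p ω x ^ 2 + (-ω * phi p ω x) ^ 2) := by
  rw [En_scaled_phi p ω ha, ← integral_energy_density_sub hl hp, En]
  have hN : 0 ≤ ∫ x : ℝ, |phi p ω x| ^ (p + 2) := integral_nonneg fun x => by positivity
  have hbern : 1 + (p + 2) * a ≤ (1 + a) ^ (p + 2) :=
    one_add_mul_self_le_rpow_one_add (by linarith) (by linarith)
  have h := mul_le_mul_of_nonneg_right hbern hN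
  generalize (∫ x : ℝ, |phi p ω x| ^ (p + 2)) = N at *
  generalize (1 + a) ^ (p + 2) = B at *
  have h' : N / (p + 2) + a * N ≤ 1 / (p + 2) * (B * N) := by
    rw [one_div_mul_eq_div, le_div_iff₀ (by linarith)]
    refine le_trans (le_of_eq ?_) h
    field_simp
  rw [one_div_mul_eq_div (p + 2) N]
  linarith

/-- A lower bound for `ρ(a,λ)/a` that is continuous in `(a,λ)`. -/
theorem rho_lower_estimate {p ω a l : ℝ} (hω : 0 < 1 - ω ^ 2) (hl : 0 < 1 - l ^ 2)
    (hp : 0 < p) (hp4 : p < 4) (ha : 0 ≤ a) (hlω : 0 ≤ l * ω) :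
    a * (4 * (8 / p - 1) * (l * ω) * (∫ x : ℝ, phi p ω x ^ 2) +
        4 * ω ^ 2 * (∫ x : ℝ, phi p ω x ^ 2) ^ 2 * (∫ x : ℝ, phi p l x ^ 2)⁻¹ -
        4 * (4 / p + 1) * ω ^ 2 * (∫ x : ℝ, phi p ω x ^ 2) - a * ((4 / p + 1) *
          ∫ x : ℝ, (deriv (phi p ω) x ^ 2 + phi p ω x ^ 2 + (-ω * phi p ω x) ^ 2))) ≤
      rho p ω a l := by
  have hE := En_scaled_phi_sub_le hω hp ha
  have hM := integral_phi_sq_pos hω hp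
  have hm := inv_pos.mpr (integral_phi_sq_pos hl hp)
  rw [rho, Qm_scaled_phi, Qm_phi]
  generalize En p (fun x => (1 + a) * phi p ω x) (fun x => -(1 + a) * ω * phi p ω x) -
      En p (phi p ω) (fun x => -ω * phi p ω x) = D at *
  generalize (∫ x : ℝ, (deriv (phi p ω) x ^ 2 + phi p ω x ^ 2 + (-ω * phi p ω x) ^ 2)) = S at *
  generalize (∫ x : ℝ, phi p ω x ^ 2) = M at *
  generalize (∫ x : ℝ, phi p l x ^ 2)⁻¹ = m at *
  have h8 : 0 ≤ 8 / p - 1 := by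
    rw [sub_nonneg, le_div_iff₀ hp]; linarith
  have h1 := mul_le_mul_of_nonneg_left hE (by positivity : 0 ≤ 2 * (4 / p + 1))
  have h2 : 0 ≤ 2 * (8 / p - 1) * (l * ω) * M * a ^ 2 := by positivity
  have h3 : 0 ≤ 2 * m * ω ^ 2 * M ^ 2 * (a ^ 2 * (5 + 4 * a + a ^ 2)) := by positivity
  have h4 : 2 * (4 - p) / p + 1 = 8 / p - 1 := by field_simp; ring
  rw [h4]
  linarith

/-- At the critical frequency `ω² = p/4`, the quantity `ρ(a,λ)` is bounded
below by `C₁ a` for small `a > 0` and `λ` close to `ω`. -/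
theorem rho_lower_bound (p ω : ℝ) (hp : 0 < p) (hp4 : p < 4)
    (hω1 : -1 < ω) (hω2 : ω < 1) (hcrit : ω ^ 2 = p / 4) :
    ∃ C₁ > 0, ∃ a₀ > 0, ∃ ε₁ > 0, ∀ a : ℝ, 0 < a → a < a₀ →
      ∀ l : ℝ, -1 < l → l < 1 → |l - ω| ≤ ε₁ →
        rho p ω a l ≥ C₁ * a := by
  have hω : 0 < 1 - ω ^ 2 := by nlinarith
  have hωsq : 0 < ω ^ 2 := by rw [hcrit]; positivity
  have hM := integral_phi_sq_pos hω hp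
  have hcontM := continuousAt_integral_phi_sq hω hp
  have key (l a : ℝ) (hl : 0 < 1 - l ^ 2) (ha : 0 ≤ a) (hlω : 0 ≤ l * ω) :=
    rho_lower_estimate hω hl hp hp4 ha hlω
  set S := ∫ x : ℝ, (deriv (phi p ω) x ^ 2 + phi p ω x ^ 2 + (-ω * phi p ω x) ^ 2)
  set M := ∫ x : ℝ, phi p ω x ^ 2 with hMdef
  set h : ℝ → ℝ := fun l => 4 * (8 / p - 1) * (l * ω) * M +
    4 * ω ^ 2 * M ^ 2 * (∫ x : ℝ, phi p l x ^ 2)⁻¹ - 4 * (4 / p + 1) * ω ^ 2 * M with hh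
  have hcont : ContinuousAt h ω := by
    have := hcontM.inv₀ hM.ne'
    refine ContinuousAt.sub (ContinuousAt.add (by fun_prop) ?_) continuousAt_const
    exact continuousAt_const.mul this
  have hval : h ω = (4 - p) * M := by
    simp only [hh]
    rw [← hMdef, ← sq, hcrit]
    field_simp
    ring
  have hδ : 0 < (4 - p) * M := mul_pos (by linarith) hM
  have hev1 : ∀ᶠ l in nhds ω, (4 - p) * M / 2 < h l :=
    hcont.eventually (lt_mem_nhds (by rw [hval]; linarith))
  have hev2 : ∀ᶠ l in nhds ω, 0 < l * ω :=
    (by fun_prop : Continuous fun l => l * ω).continuousAt.eventually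
      (lt_mem_nhds (by simpa only [sq] using hωsq))
  obtain ⟨ε, hε, hball⟩ := Metric.eventually_nhds_iff.mp (hev1.and hev2)
  have hS : 0 ≤ S := integral_nonneg fun x => by positivity
  have hT : 0 ≤ (4 / p + 1) * S := by positivity
  refine ⟨(4 - p) * M / 4, by linarith, (4 - p) * M / (4 * ((4 / p + 1) * S + 1)),
    by positivity, ε / 2, by linarith, fun a ha ha0 l hl1 hl2 hlε => ?_⟩
  obtain ⟨hb1, hb2⟩ := hball (show dist l ω < ε by rw [dist_eq]; linarith)
  have hk := key l a (by nlinarith) ha.le hb2.le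
  rw [lt_div_iff₀ (by positivity)] at ha0
  have hlow : (4 - p) * M / 4 ≤ h l - a * ((4 / p + 1) * S) := by linarith
  have := mul_le_mul_of_nonneg_left hlow ha.le
  simp only [hh] at this
  linarith
end
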